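/- The number of n-tuples (A₁,...,Aₙ) of pairwise commuting elements of GL₂(F_q) is (1/2)·q·(q²−1)·(2(q²−q)^{n−1} − 2(q−1)^{n−1} + (q−1)(q²−1)^{n−1} + (q−1)^{2n−1}). -/

import Mathlib

open Finset

/-- Counting commuting tuples in a finite group whose noncentral elements are partitioned by a
family of subsets `S i`, each of which is the centralizer of any of its noncentral elements. -/
theorem card_commuting_tuples {G ι : Type*} [Group G] [Fintype G] [Fintype ι] [DecidableEq G]
    (Z : Finset G) (S : ι → Finset G) (hZ : ∀ g ∈ Z, ∀ h, g * h = h * g)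
    (hZS : ∀ i, Z ⊆ S i) (hex : ∀ g ∉ Z, ∃ i, g ∈ S i)
    (huniq : ∀ g ∉ Z, ∀ i j, g ∈ S i → g ∈ S j → i = j)
    (hcomm : ∀ i, ∀ g ∈ S i, g ∉ Z → ∀ h, h ∈ S i ↔ g * h = h * g) (n : ℕ) :
    (Nat.card {f : Fin n → G // ∀ i j, f i * f j = f j * f i} : ℚ) =
      (#Z : ℚ) ^ n + ∑ i, ((#(S i) : ℚ) ^ n - (#Z : ℚ) ^ n) := by
  classical
  let T : Finset G → Finset (Fin n → G) := fun s => Fintype.piFinset fun _ => s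
  have hT : ∀ s, (#(T s) : ℚ) = (#s : ℚ) ^ n := fun s => by simp [T]
  have hV : (univ.filter fun f : Fin n → G => ∀ i j, f i * f j = f j * f i) =
      T Z ∪ univ.biUnion fun i => T (S i) \ T Z := by
    ext f
    simp only [mem_filter, mem_univ, true_and, mem_union, mem_biUnion, mem_sdiff, T,
      Fintype.mem_piFinset]
    constructor
    · intro hf
      by_cases hfZ : ∀ a, f a ∈ Z
      · exact Or.inl hfZ
      · obtain ⟨a, ha⟩ := not_forall.1 hfZ
        obtain ⟨i, hi⟩ := hex _ ha
        exact Or.inr ⟨i, fun b => (hcomm i _ hi ha _).2 (hf a b), hfZ⟩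
    · rintro (hf | ⟨i, hf, -⟩) a b
      · exact hZ _ (hf a) _
      · by_cases ha : f a ∈ Z
        · exact hZ _ ha _
        · exact (hcomm i _ (hf a) ha _).1 (hf b)
  have hdisj : Disjoint (T Z) (univ.biUnion fun i => T (S i) \ T Z) := by
    rw [disjoint_biUnion_right]
    exact fun i _ => disjoint_sdiff
  have hpair : Set.PairwiseDisjoint (↑(univ : Finset ι)) fun i => T (S i) \ T Z := by
    intro i _ j _ hij
    refine disjoint_left.2 fun f hfi hfj => hij ?_
    simp only [mem_sdiff, T, Fintype.mem_piFinset, not_forall] at hfi hfj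
    obtain ⟨hfi, a, ha⟩ := hfi
    exact huniq _ ha i j (hfi a) (hfj.1 a)
  rw [Nat.card_eq_fintype_card, Fintype.card_subtype, hV, card_union_of_disjoint hdisj,
    card_biUnion hpair]
  push_cast
  rw [hT]
  congr 1
  refine sum_congr rfl fun i _ => ?_
  rw [cast_card_sdiff (Fintype.piFinset_subset _ _ fun _ => hZS i), hT, hT]

section Quadratic

variable {F : Type*} [Field F] [Fintype F] [DecidableEq F]

/-- The roots of `X ^ 2 + t * X - c`. -/
def quadraticRoots (t c : F) : Finset F := univ.filter fun s => s ^ 2 + t * s = c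

theorem quadraticRoots_eq_pair (t s : F) :
    quadraticRoots t (s ^ 2 + t * s) = {s, -t - s} := by
  ext x
  simp only [quadraticRoots, mem_filter, mem_univ, true_and, mem_insert, mem_singleton]
  constructor
  · intro h
    have : (x - s) * (x - (-t - s)) = 0 := by linear_combination h
    rcases mul_eq_zero.1 this with h | h
    · exact Or.inl (sub_eq_zero.1 h)
    · exact Or.inr (sub_eq_zero.1 h)
  · rintro (rfl | rfl) <;> ring

theorem card_quadraticRoots (t s : F) :
    #(quadraticRoots t (s ^ 2 + t * s)) = if t = -s - s then 1 else 2 := by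
  rw [quadraticRoots_eq_pair]
  split_ifs with h
  · simp [h]
  · refine card_pair fun h' => h ?_
    linear_combination h'

theorem card_quadraticRoots_zero (t : F) :
    #(quadraticRoots t 0) = if t = 0 then 1 else 2 := by
  simpa using card_quadraticRoots t 0

theorem sum_ite_eq_else (a : F) (x y : ℚ) :
    ∑ t : F, (if t = a then x else y) = x + ((Fintype.card F : ℚ) - 1) * y := by
  rw [← add_sum_erase _ _ (mem_univ a), if_pos rfl,
    sum_congr rfl fun t ht => if_neg (ne_of_mem_erase ht), sum_const, card_erase_of_mem
    (mem_univ a), nsmul_eq_mul, card_univ, Nat.cast_sub Fintype.card_pos, Nat.cast_one]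

/-- The sum of a function of the number of roots over all monic quadratic polynomials. -/
theorem sum_card_quadraticRoots (g : ℕ → ℚ) :
    ∑ p : F × F, g #(quadraticRoots p.1 p.2) =
      (Fintype.card F : ℚ) ^ 2 * g 0 + (Fintype.card F : ℚ) * (g 1 - g 0) +
        (Fintype.card F : ℚ) * ((Fintype.card F : ℚ) - 1) * ((g 2 - g 0) / 2) := by
  let H : ℕ → ℚ := fun k => (g k - g 0) / k
  have hg : ∀ k : ℕ, g k = g 0 + k * H k := by
    intro k
    rcases eq_or_ne k 0 with rfl | hk
    · simp
    · have : (k : ℚ) ≠ 0 := Nat.cast_ne_zero.2 hk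
      simp only [H]
      field_simp
      ring
  have hroots : ∀ t : F, ∑ c : F, (#(quadraticRoots t c) : ℚ) * H #(quadraticRoots t c) =
      ∑ s : F, H #(quadraticRoots t (s ^ 2 + t * s)) := by
    intro t
    refine Eq.trans ?_ (sum_fiberwise univ (fun s : F => s ^ 2 + t * s) _)
    refine sum_congr rfl fun c _ => ?_
    rw [sum_congr rfl (g := fun _ => H #(quadraticRoots t c)), sum_const, nsmul_eq_mul]
    · rfl
    · intro s hs
      rw [(mem_filter.1 hs).2]
  rw [Fintype.sum_prod_type, sum_congr rfl fun t _ => sum_congr rfl fun c _ => hg _]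
  simp only [sum_add_distrib, hroots]
  rw [sum_comm (f := fun t s : F => H #(quadraticRoots t (s ^ 2 + t * s)))]
  simp only [card_quadraticRoots, apply_ite H, sum_ite_eq_else]
  simp only [sum_const, card_univ, nsmul_eq_mul, H]
  push_cast
  ring

/-- The number of nonzeros of a binary quadratic form `x ^ 2 + t * x * y - c * y ^ 2`. -/
theorem card_quadraticForm_ne_zero (t c : F) :
    (#(univ.filter fun p : F × F => (p.1 + t * p.2) * p.1 - c * p.2 ^ 2 ≠ 0) : ℚ) =
      ((Fintype.card F : ℚ) - 1) * ((Fintype.card F : ℚ) + 1 - #(quadraticRoots t c)) := by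
  have hfib : ∀ y : F,
      (∑ x : F, if (x + t * y) * x - c * y ^ 2 ≠ 0 then (1 : ℚ) else 0) =
        if y = 0 then (Fintype.card F : ℚ) - 1
        else (Fintype.card F : ℚ) - #(quadraticRoots t c) := by
    intro y
    split_ifs with hy
    · subst hy
      have : ∀ x : F, (if (x + t * 0) * x - c * 0 ^ 2 ≠ 0 then (1 : ℚ) else 0) =
          if x = 0 then 0 else 1 := by
        intro x
        by_cases hx : x = 0 <;> simp [hx]
      simp only [this, sum_ite_eq_else]
      ring
    · rw [← Equiv.sum_comp (Equiv.mulRight₀ y hy)]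
      have : ∀ s : F, (if (Equiv.mulRight₀ y hy s + t * y) * Equiv.mulRight₀ y hy s -
          c * y ^ 2 ≠ 0 then (1 : ℚ) else 0) = 1 - if s ^ 2 + t * s = c then 1 else 0 := by
        intro s
        have h : (s * y + t * y) * (s * y) - c * y ^ 2 = (s ^ 2 + t * s - c) * y ^ 2 := by ring
        simp only [Equiv.mulRight₀_apply, h]
        by_cases hs : s ^ 2 + t * s = c
        · simp [hs]
        · simp [hs, hy, sub_eq_zero]
      simp only [this, sum_sub_distrib, sum_boole, quadraticRoots]
      simp
  rw [← sum_boole, Fintype.sum_prod_type_right]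
  simp only [hfib, sum_ite_eq_else]
  ring

end Quadratic

section GeneralLinear

variable {F : Type*} [Field F] [Fintype F] [DecidableEq F]

/-- The scalar matrices in `GL₂(F)`. -/
def scalarGL (F : Type*) [Field F] [Fintype F] [DecidableEq F] : Finset (GL (Fin 2) F) :=
  univ.filter fun A => A 0 0 - A 1 1 = 0 ∧ A 0 1 = 0 ∧ A 1 0 = 0

/-- The maximal commutative subgroups of `GL₂(F)`, indexed by the points of the projective plane
of matrices modulo scalars. -/
def maxCommGL : F × F ⊕ F ⊕ Unit → Finset (GL (Fin 2) F)
  | .inl p => univ.filter fun A => A 0 0 - A 1 1 = p.1 * A 0 1 ∧ A 1 0 = p.2 * A 0 1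
  | .inr (.inl t) => univ.filter fun A => A 0 0 - A 1 1 = t * A 1 0 ∧ A 0 1 = 0
  | .inr (.inr _) => univ.filter fun A => A 0 1 = 0 ∧ A 1 0 = 0

theorem GL_mul_comm_iff {F : Type*} [Field F] (A B : GL (Fin 2) F) :
    A * B = B * A ↔ A 0 1 * B 1 0 = B 0 1 * A 1 0 ∧
      (A 0 0 - A 1 1) * B 0 1 = (B 0 0 - B 1 1) * A 0 1 ∧
      (A 0 0 - A 1 1) * B 1 0 = (B 0 0 - B 1 1) * A 1 0 := by
  rw [Units.ext_iff, ← Matrix.ext_iff]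
  simp only [Fin.forall_fin_two, Units.val_mul, Matrix.mul_apply, Fin.sum_univ_two]
  constructor
  · rintro ⟨⟨h1, h2⟩, h3, h4⟩
    refine ⟨?_, ?_, ?_⟩
    · linear_combination h1
    · linear_combination h2
    · linear_combination -h3
  · rintro ⟨h1, h2, h3⟩
    refine ⟨⟨?_, ?_⟩, ?_, ?_⟩
    · linear_combination h1
    · linear_combination h2
    · linear_combination -h3
    · linear_combination -h1

theorem card_GL_filter_eq (P : GL (Fin 2) F → Prop) [DecidablePred P] (t c : F)
    (M : F × F → Matrix (Fin 2) (Fin 2) F) (N : Matrix (Fin 2) (Fin 2) F → F × F)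
    (hdet : ∀ p, (M p).det = (p.1 + t * p.2) * p.1 - c * p.2 ^ 2)
    (hNM : ∀ p, N (M p) = p) (hP : ∀ A : GL (Fin 2) F, P A ↔ M (N A.1) = A.1) :
    (#(univ.filter P) : ℚ) =
      ((Fintype.card F : ℚ) - 1) * ((Fintype.card F : ℚ) + 1 - #(quadraticRoots t c)) := by
  rw [← card_quadraticForm_ne_zero]
  congr 1
  refine card_bij (fun A _ => N A.1) ?_ ?_ ?_
  · intro A hA
    have h := (hP A).1 (mem_filter.1 hA).2
    simp only [mem_filter, mem_univ, true_and]
    rw [← hdet, h]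
    exact ((Matrix.isUnit_iff_isUnit_det _).1 A.isUnit).ne_zero
  · intro A hA B hB h
    refine Units.ext ?_
    rw [← (hP A).1 (mem_filter.1 hA).2, ← (hP B).1 (mem_filter.1 hB).2, h]
  · intro p hp
    have hp' : (M p).det ≠ 0 := by
      rw [hdet]
      exact (mem_filter.1 hp).2
    refine ⟨Matrix.GeneralLinearGroup.mkOfDetNeZero (M p) hp', ?_, hNM p⟩
    simp only [mem_filter, mem_univ, true_and, hP]
    change M (N (M p)) = M p
    rw [hNM]

theorem card_maxCommGL_inl (p : F × F) :
    (#(maxCommGL (.inl p)) : ℚ) =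
      ((Fintype.card F : ℚ) - 1) * ((Fintype.card F : ℚ) + 1 - #(quadraticRoots p.1 p.2)) := by
  refine card_GL_filter_eq _ p.1 p.2 (fun x => !![x.1 + p.1 * x.2, x.2; p.2 * x.2, x.1])
    (fun A => (A 1 1, A 0 1)) (fun x => ?_) (fun x => ?_) (fun A => ?_)
  · rw [Matrix.det_fin_two_of]
    ring
  · simp
  · rw [← Matrix.ext_iff]
    simp only [Fin.forall_fin_two, Matrix.of_apply, Matrix.cons_val]
    grind

theorem card_maxCommGL_inr_inl (t : F) :
    (#(maxCommGL (.inr (.inl t))) : ℚ) =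
      ((Fintype.card F : ℚ) - 1) * ((Fintype.card F : ℚ) + 1 - #(quadraticRoots t 0)) := by
  refine card_GL_filter_eq _ t 0 (fun x => !![x.1 + t * x.2, 0; x.2, x.1])
    (fun A => (A 1 1, A 1 0)) (fun x => ?_) (fun x => ?_) (fun A => ?_)
  · rw [Matrix.det_fin_two_of]
    ring
  · simp
  · rw [← Matrix.ext_iff]
    simp only [Fin.forall_fin_two, Matrix.of_apply, Matrix.cons_val]
    grind

theorem card_maxCommGL_inr_inr (u : Unit) :
    (#(maxCommGL (F := F) (.inr (.inr u))) : ℚ) = ((Fintype.card F : ℚ) - 1) ^ 2 := by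
  have h : (#(quadraticRoots (1 : F) 0) : ℚ) = 2 := by simp [card_quadraticRoots_zero]
  have key : (#(maxCommGL (F := F) (.inr (.inr u))) : ℚ) =
      ((Fintype.card F : ℚ) - 1) * ((Fintype.card F : ℚ) + 1 - #(quadraticRoots (1 : F) 0)) := by
    refine card_GL_filter_eq _ 1 0 (fun x => !![x.1 + x.2, 0; 0, x.1])
      (fun A => (A 1 1, A 0 0 - A 1 1)) (fun x => ?_) (fun x => ?_) (fun A => ?_)
    · rw [Matrix.det_fin_two_of]
      ring
    · simp
    · rw [← Matrix.ext_iff]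
      simp [Fin.forall_fin_two, eq_comm]
  rw [key, h]
  ring

theorem card_scalarGL : (#(scalarGL F) : ℚ) = (Fintype.card F : ℚ) - 1 := by
  rw [← Nat.cast_one, ← Nat.cast_sub Fintype.card_pos, ← Fintype.card_units, ← card_univ]
  congr 1
  symm
  refine card_bij (fun a _ => Matrix.GeneralLinearGroup.scalar (Fin 2) a) ?_ ?_ ?_
  · intro a _
    simp [scalarGL]
  · intro a _ b _ h
    have := congrArg (fun A : GL (Fin 2) F => A 0 0) h
    exact Units.ext (by simpa using this)
  · intro A hA
    simp only [scalarGL, mem_filter, mem_univ, true_and] at hA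
    obtain ⟨h1, h2, h3⟩ := hA
    have hdet := ((Matrix.isUnit_iff_isUnit_det _).1 A.isUnit).ne_zero
    rw [Matrix.det_fin_two] at hdet
    have h0 : A 0 0 ≠ 0 := fun h => hdet (by rw [h, h2]; ring)
    refine ⟨Units.mk0 _ h0, mem_univ _, ?_⟩
    refine Units.ext ?_
    rw [← Matrix.ext_iff]
    simp [Fin.forall_fin_two, h2, h3, sub_eq_zero.1 h1]

theorem card_commuting_tuples_GL (n : ℕ) :
    (Nat.card {f : Fin n → GL (Fin 2) F // ∀ i j, f i * f j = f j * f i} : ℚ) =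
      (#(scalarGL F) : ℚ) ^ n +
        ∑ i, ((#(maxCommGL (F := F) i) : ℚ) ^ n - (#(scalarGL F) : ℚ) ^ n) := by
  refine card_commuting_tuples _ _ ?_ ?_ ?_ ?_ ?_ n
  · intro A hA B
    simp only [scalarGL, mem_filter, mem_univ, true_and] at hA
    rw [GL_mul_comm_iff]
    simp [hA]
  · rintro (p | t | u) A hA <;>
      simp only [scalarGL, maxCommGL, mem_filter, mem_univ, true_and] at hA ⊢ <;> simp [hA]
  · intro A hA
    simp only [scalarGL, mem_filter, mem_univ, true_and] at hA
    by_cases h1 : A 0 1 = 0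
    · by_cases h2 : A 1 0 = 0
      · exact ⟨.inr (.inr ()), by simp [maxCommGL, h1, h2]⟩
      · exact ⟨.inr (.inl ((A 0 0 - A 1 1) / A 1 0)), by simp [maxCommGL, h1, h2]⟩
    · exact ⟨.inl ((A 0 0 - A 1 1) / A 0 1, A 1 0 / A 0 1), by simp [maxCommGL, h1]⟩
  · rintro A hA (⟨t, c⟩ | t | u) (⟨t', c'⟩ | t' | u') <;>
      simp only [scalarGL, maxCommGL, mem_filter, mem_univ, true_and] at hA ⊢ <;> grind
  · rintro (⟨t, c⟩ | t | u) A hAS hA B <;>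
      simp only [scalarGL, maxCommGL, mem_filter, mem_univ, true_and, GL_mul_comm_iff]
        at hA hAS ⊢ <;> grind

end GeneralLinear


/-- The number of `n`-tuples of pairwise commuting elements of `GL₂(F_q)` is
`(1/2)·q·(q²−1)·(2(q²−q)^{n−1} − 2(q−1)^{n−1} + (q−1)(q²−1)^{n−1} + (q−1)^{2n−1})`. -/
theorem stmt_12 (F : Type*) [Field F] [Fintype F] (n : ℕ) (hn : 1 ≤ n) :
    (Nat.card {f : Fin n → GL (Fin 2) F // ∀ i j, f i * f j = f j * f i} : ℚ) =
      (1 / 2) * (Fintype.card F : ℚ) * ((Fintype.card F : ℚ) ^ 2 - 1) *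
        (2 * ((Fintype.card F : ℚ) ^ 2 - Fintype.card F) ^ (n - 1) -
          2 * ((Fintype.card F : ℚ) - 1) ^ (n - 1) +
          ((Fintype.card F : ℚ) - 1) * ((Fintype.card F : ℚ) ^ 2 - 1) ^ (n - 1) +
          ((Fintype.card F : ℚ) - 1) ^ (2 * n - 1)) := by
  classical
  obtain ⟨m, rfl⟩ := Nat.exists_eq_add_of_le' hn
  rw [card_commuting_tuples_GL, Fintype.sum_sum_type, Fintype.sum_sum_type]
  simp only [card_maxCommGL_inl, card_maxCommGL_inr_inl, card_maxCommGL_inr_inr, card_scalarGL]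
  generalize hg : (fun k : ℕ => (((Fintype.card F : ℚ) - 1) * ((Fintype.card F : ℚ) + 1 - k)) ^
    (m + 1) - ((Fintype.card F : ℚ) - 1) ^ (m + 1)) = g
  have hg' := congrFun hg
  simp only [hg', sum_card_quadraticRoots, card_quadraticRoots_zero, apply_ite g,
    sum_ite_eq_else]
  simp only [← hg']
  have h0 : ((Fintype.card F : ℚ)) ^ 2 - 1 =
      ((Fintype.card F : ℚ) - 1) * ((Fintype.card F : ℚ) + 1) := by ring
  have h1 : ((Fintype.card F : ℚ)) ^ 2 - Fintype.card F =
      ((Fintype.card F : ℚ) - 1) * (Fintype.card F : ℚ) := by ring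
  have h2 : 2 * (m + 1) - 1 = 2 * m + 1 := by omega
  simp only [h0, h1, h2, Nat.add_sub_cancel, univ_unique, sum_singleton]
  generalize (Fintype.card F : ℚ) = q
  have h3 : (q - 1) * (q + 1 - (2 : ℕ)) = (q - 1) ^ 2 := by push_cast; ring
  have h4 : (q - 1) * (q + 1 - (1 : ℕ)) = (q - 1) * q := by push_cast; ring
  simp only [h3, h4, Nat.cast_zero, sub_zero]
  simp only [mul_pow, pow_succ, pow_mul, pow_zero, one_mul]
  ring
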